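/- Let $|\cdot|$ denote the Euclidean norm on $\mathbb{R}^n$ and $\|A\|$ the corresponding operator norm of an $n\times n$ matrix $A$, and let $Q(z,r)$ denote the cube in $\mathbb{R}^n$ centered at $z$ with side length $r>0$ (sides parallel to the axes). Let $m\ge 1$, let $A_1,\dots,A_m$ be $n\times n$ invertible real matrices, let $0\le\alpha<n$, let $\alpha_1,\dots,\alpha_m>0$ with $\alpha_1+\cdots+\alpha_m=n-\alpha$, and set $k(x,y)=|x-A_1y|^{-\alpha_1}\cdots|x-A_my|^{-\alpha_m}$ and $D=\max_{1\le i\le m}\|A_i\|$. Let $d\in\mathbb{N}=\{0,1,2,\dots\}$ and let $\kappa>\sqrt n/2$ (for instance $\kappa=2\sqrt n$ in every dimension, or $\kappa=2$ if $n\le 15$). Then there is a constant $C>0$, depending only on $n$, $d$, $m$, $\kappa$, the matrices and the exponents, such that the following holds for every cube $Q=Q(z,r)$, every $y\in Q$, every index $k\in\{1,\dots,m\}$ and every $x\in\mathbb{R}^n$ satisfying $|x-A_iz|\ge \kappa Dr$ and $|x-A_kz|\le|x-A_iz|$ for all $1\le i\le m$: $$|k(x,y)-q_d(x,y)|\le C\,r^{d+1}\,|x-A_kz|^{-(n-\alpha+d+1)},$$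 where $q_d(x,y)=\sum_{|\gamma|\le d}\frac{1}{\gamma!}\,\partial_y^\gamma k(x,z)\,(y-z)^\gamma$ is the degree-$d$ Taylor polynomial at $z$ of the function $y\mapsto k(x,y)$. -/

import Mathlib

noncomputable section

/-- Euclidean space `ℝⁿ`. -/
abbrev Rn (n : ℕ) := EuclideanSpace ℝ (Fin n)

/-- The (closed) cube centered at `z` with side length `r`. -/
def cube {n : ℕ} (z : Rn n) (r : ℝ) : Set (Rn n) := {x | ∀ i, |x i - z i| ≤ r / 2}

/-- Action of an `n × n` matrix on `ℝⁿ`. -/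
def mApp {n : ℕ} (A : Matrix (Fin n) (Fin n) ℝ) (x : Rn n) : Rn n :=
  Matrix.toEuclideanLin A x

/-- The operator norm of a matrix acting on Euclidean space. -/
def opNorm {n : ℕ} (A : Matrix (Fin n) (Fin n) ℝ) : ℝ :=
  ‖Matrix.toEuclideanCLM (𝕜 := ℝ) A‖

/-- The kernel `k(x,y) = |x - A₁ y|^{-α₁} ⋯ |x - A_m y|^{-α_m}`. -/
def kern {n m : ℕ} (A : Fin m → Matrix (Fin n) (Fin n) ℝ) (αe : Fin m → ℝ)
    (x y : Rn n) : ℝ :=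
  ∏ i, ‖x - mApp (A i) y‖ ^ (-(αe i))

/-- Partial derivative in the `i`-th coordinate direction. -/
def pderiv1 {n : ℕ} (i : Fin n) (g : Rn n → ℝ) : Rn n → ℝ :=
  fun x => fderiv ℝ g x (EuclideanSpace.single i 1)

/-- The multiindex partial derivative `∂^γ`. -/
def mderiv {n : ℕ} (γ : Fin n → ℕ) (g : Rn n → ℝ) : Rn n → ℝ :=
  (List.finRange n).foldr (fun i h => (pderiv1 i)^[γ i] h) g

/-- The finite set of multiindices `γ` with `|γ| ≤ N`. -/
def multiIndices (n N : ℕ) : Finset (Fin n → ℕ) :=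
  (Fintype.piFinset fun _ => Finset.range (N + 1)).filter (fun γ => (∑ i, γ i) ≤ N)

/-- `γ! = γ₁! ⋯ γ_n!`. -/
def mfact {n : ℕ} (γ : Fin n → ℕ) : ℕ := ∏ i, (γ i).factorial

/-- The degree-`d` Taylor polynomial of `g` at `z`, evaluated at `y`. -/
def taylorPoly {n : ℕ} (d : ℕ) (g : Rn n → ℝ) (z y : Rn n) : ℝ :=
  ∑ γ ∈ multiIndices n d, (mderiv γ g z / (mfact γ : ℝ)) * ∏ i, (y i - z i) ^ γ i

end

open Set
open scoped ContDiff

theorem norm_iteratedFDeriv_comp_line_le {E F : Type*} [NormedAddCommGroup E] [NormedSpace ℝ E]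
    [NormedAddCommGroup F] [NormedSpace ℝ F] {f : E → F} {U : Set E} (hU : IsOpen U)
    {p : ℕ} (hf : ContDiffOn ℝ p f U) (v w : E) {t : ℝ} (ht : v + t • w ∈ U) :
    ‖iteratedFDeriv ℝ p (fun s : ℝ => f (v + s • w)) t‖ ≤
      ‖iteratedFDeriv ℝ p f (v + t • w)‖ * ‖w‖ ^ p := by
  set L : ℝ →L[ℝ] E := ContinuousLinearMap.toSpanSingleton ℝ w with hL
  set V : Set E := (fun e => v + e) ⁻¹' U
  have hV : IsOpen V := hU.preimage (by fun_prop)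
  have hg : ContDiffOn ℝ p (fun e => f (v + e)) V :=
    hf.comp (by fun_prop) (fun _ h => h)
  have hLV : IsOpen (L ⁻¹' V) := hV.preimage L.continuous
  have htV : L t ∈ V := by simpa [V, hL] using ht
  have key := L.iteratedFDerivWithin_comp_right hg hV.uniqueDiffOn hLV.uniqueDiffOn htV le_rfl
  rw [iteratedFDerivWithin_of_isOpen p hLV htV, iteratedFDerivWithin_of_isOpen p hV htV,
    iteratedFDeriv_comp_add_left] at key
  have hfun : (fun s : ℝ => f (v + s • w)) = (fun e => f (v + e)) ∘ L := by
    ext s; simp [hL]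
  rw [hfun, key]
  refine (ContinuousMultilinearMap.norm_compContinuousLinearMap_le _ _).trans ?_
  simp [hL]

theorem contDiffOn_norm_rpow {E : Type*} [NormedAddCommGroup E] [InnerProductSpace ℝ E]
    (a : ℝ) {p : WithTop ℕ∞} : ContDiffOn ℝ p (fun u : E => ‖u‖ ^ a) {0}ᶜ := by
  intro u hu
  exact (((contDiffAt_norm ℝ hu).rpow_const_of_ne
    (norm_ne_zero_iff.2 hu))).contDiffWithinAt

theorem norm_iteratedFDeriv_norm_rpow_smul {E : Type*} [NormedAddCommGroup E]
    [InnerProductSpace ℝ E] (a : ℝ) (p : ℕ) {c : ℝ} (hc : 0 < c) {u : E} (hu : u ≠ 0) :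
    ‖iteratedFDeriv ℝ p (fun u : E => ‖u‖ ^ a) (c • u)‖ =
      c ^ (a - p) * ‖iteratedFDeriv ℝ p (fun u : E => ‖u‖ ^ a) u‖ := by
  set f : E → ℝ := fun u => ‖u‖ ^ a with hf
  set g : E →L[ℝ] E := c • ContinuousLinearMap.id ℝ E with hg
  have hU : IsOpen ({0}ᶜ : Set E) := isOpen_compl_singleton
  have hpre : g ⁻¹' {0}ᶜ = ({0}ᶜ : Set E) := by
    ext x; simp [hg, hc.ne']
  have hgu : g u ∈ ({0}ᶜ : Set E) := by simp [hg, hc.ne', hu]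
  have key := g.iteratedFDerivWithin_comp_right (contDiffOn_norm_rpow (E := E) a (p := p))
    hU.uniqueDiffOn (by rw [hpre]; exact hU.uniqueDiffOn) hgu le_rfl
  rw [hpre, iteratedFDerivWithin_of_isOpen p hU hu, iteratedFDerivWithin_of_isOpen p hU hgu] at key
  have hcomp : f ∘ g = c ^ a • f := by
    ext x
    simp [hf, hg, norm_smul, abs_of_pos hc, Real.mul_rpow hc.le (norm_nonneg x)]
  have hright : (iteratedFDeriv ℝ p f (g u)).compContinuousLinearMap (fun _ => g) =
      c ^ p • iteratedFDeriv ℝ p f (c • u) := by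
    ext v
    simp only [ContinuousMultilinearMap.compContinuousLinearMap_apply]
    have : (fun i => g (v i)) = fun i => c • v i := by ext i; simp [hg]
    rw [this, ContinuousMultilinearMap.map_smul_univ]
    simp [hg]
  change iteratedFDeriv ℝ p (f ∘ g) u = _ at key
  have hca : ContDiffAt ℝ p f u := (contDiffOn_norm_rpow a).contDiffAt (hU.mem_nhds hu)
  rw [hcomp, iteratedFDeriv_const_smul_apply hca] at key
  have key2 := congrArg norm (key.trans hright)
  rw [norm_smul, norm_smul, Real.norm_of_nonneg (by positivity),
    Real.norm_of_nonneg (by positivity)] at key2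
  rw [Real.rpow_sub hc, Real.rpow_natCast]
  field_simp
  linarith

theorem exists_norm_iteratedFDeriv_norm_rpow_le (E : Type*) [NormedAddCommGroup E]
    [InnerProductSpace ℝ E] [FiniteDimensional ℝ E] (a : ℝ) (p : ℕ) :
    ∃ M : ℝ, 0 ≤ M ∧ ∀ u : E, u ≠ 0 →
      ‖iteratedFDeriv ℝ p (fun u : E => ‖u‖ ^ a) u‖ ≤ M * ‖u‖ ^ (a - p) := by
  have hU : IsOpen ({0}ᶜ : Set E) := isOpen_compl_singleton
  have hcont : ContinuousOn (fun u => iteratedFDeriv ℝ p (fun u : E => ‖u‖ ^ a) u)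
      (Metric.sphere 0 1) := by
    have h := (contDiffOn_norm_rpow (E := E) a (p := p)).continuousOn_iteratedFDerivWithin
      le_rfl hU.uniqueDiffOn
    refine (h.congr fun u hu => (iteratedFDerivWithin_of_isOpen p hU hu).symm).mono ?_
    intro u hu
    exact ne_zero_of_mem_unit_sphere ⟨u, hu⟩
  obtain ⟨M, hM⟩ := (isCompact_sphere (0 : E) 1).exists_bound_of_continuousOn hcont
  refine ⟨max M 0, le_max_right _ _, fun u hu => ?_⟩
  have hu' : 0 < ‖u‖ := norm_pos_iff.2 hu
  have hw : ‖u‖⁻¹ • u ∈ Metric.sphere (0 : E) 1 := by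
    simp [norm_smul, hu'.ne']
  have h := norm_iteratedFDeriv_norm_rpow_smul a p hu' (ne_zero_of_mem_unit_sphere ⟨_, hw⟩)
  rw [smul_inv_smul₀ hu'.ne'] at h
  rw [h, mul_comm]
  gcongr
  exact (hM _ hw).trans (le_max_left _ _)

/-- Along a line that stays at distance at least `ρ` from the origin, the derivatives of order `p`
of a negative power of the norm decay like `ρ ^ (-(a + p))`. -/
theorem exists_norm_iteratedFDeriv_norm_rpow_line_le (E : Type*) [NormedAddCommGroup E]
    [InnerProductSpace ℝ E] [FiniteDimensional ℝ E] {a : ℝ} (ha : 0 < a) (p : ℕ) :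
    ∃ M : ℝ, 0 ≤ M ∧ ∀ (v w : E) (ρ W t : ℝ), 0 < ρ → ρ ≤ ‖v + t • w‖ → ‖w‖ ≤ W →
      ‖iteratedFDeriv ℝ p (fun s : ℝ => ‖v + s • w‖ ^ (-a)) t‖ ≤ M * ρ ^ (-a) * (W / ρ) ^ p := by
  obtain ⟨M, hM0, hM⟩ := exists_norm_iteratedFDeriv_norm_rpow_le E (-a) p
  refine ⟨M, hM0, fun v w ρ W t hρ hv hw => ?_⟩
  have hne : v + t • w ≠ 0 := norm_pos_iff.1 (hρ.trans_le hv)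
  refine (norm_iteratedFDeriv_comp_line_le (U := {0}ᶜ) isOpen_compl_singleton
    (contDiffOn_norm_rpow (-a)) v w hne).trans ?_
  have h1 : ‖v + t • w‖ ^ (-a - p) ≤ ρ ^ (-a - p) :=
    Real.rpow_le_rpow_of_nonpos hρ hv (by have : (0:ℝ) ≤ p := p.cast_nonneg; linarith)
  calc _ ≤ M * ρ ^ (-a - p) * W ^ p := by
        have hpow : ‖w‖ ^ p ≤ W ^ p := by gcongr
        exact mul_le_mul ((hM _ hne).trans (by gcongr)) hpow (by positivity) (by positivity)
    _ = _ := by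
        rw [Real.rpow_sub hρ, Real.rpow_natCast, div_pow]; ring

theorem exists_norm_iteratedDerivWithin_prod_line_le (E : Type*) [NormedAddCommGroup E]
    [InnerProductSpace ℝ E] [FiniteDimensional ℝ E] {ι : Type*} [Fintype ι]
    {a : ι → ℝ} (ha : ∀ i, 0 < a i) (N : ℕ) :
    ∃ M : ℝ, 0 ≤ M ∧ ∀ (v w : ι → E) (ρ W : ℝ), 0 < ρ →
      (∀ i, ∀ t ∈ Icc (0 : ℝ) 1, ρ ≤ ‖v i + t • w i‖) → (∀ i, ‖w i‖ ≤ W) →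
      ∀ t ∈ Icc (0 : ℝ) 1,
        ‖iteratedDerivWithin N (fun s : ℝ => ∏ i, ‖v i + s • w i‖ ^ (-a i)) (Icc 0 1) t‖ ≤
          M * ρ ^ (-∑ i, a i) * (W / ρ) ^ N := by
  classical
  choose M hM0 hM using fun i p => exists_norm_iteratedFDeriv_norm_rpow_line_le E (ha i) p
  refine ⟨∑ p ∈ (Finset.univ : Finset ι).sym N, (p : Multiset ι).countPerms *
    ∏ i, M i (Multiset.count i p), Finset.sum_nonneg fun p _ => mul_nonneg (by positivity)
      (Finset.prod_nonneg fun i _ => hM0 _ _), fun v w ρ W hρ hv hw t ht => ?_⟩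
  have hcd : ∀ i, ∀ s ∈ Icc (0 : ℝ) 1,
      ContDiffAt ℝ N (fun s : ℝ => ‖v i + s • w i‖ ^ (-a i)) s := by
    intro i s hs
    have hne : v i + s • w i ≠ 0 := norm_pos_iff.1 (hρ.trans_le (hv i s hs))
    exact ((contDiffOn_norm_rpow (-a i)).contDiffAt
      (isOpen_compl_singleton.mem_nhds hne)).comp s
        (g := fun u : E => ‖u‖ ^ (-a i)) (f := fun s : ℝ => v i + s • w i) (by fun_prop)
  have huniq : UniqueDiffOn ℝ (Icc (0 : ℝ) 1) := uniqueDiffOn_Icc zero_lt_one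
  rw [← norm_iteratedFDerivWithin_eq_norm_iteratedDerivWithin]
  refine (norm_iteratedFDerivWithin_prod_le (N := N)
    (fun i _ s hs => (hcd i s hs).contDiffWithinAt) huniq ht le_rfl).trans ?_
  rw [Finset.sum_mul, Finset.sum_mul]
  refine Finset.sum_le_sum fun p _ => ?_
  rw [mul_assoc, mul_assoc]
  gcongr
  have hcount : ∑ i, Multiset.count i (p : Multiset ι) = N := by
    rw [Multiset.sum_count_eq_card (fun i _ => Finset.mem_univ i)]; exact p.2
  calc ∏ i, ‖iteratedFDerivWithin ℝ (Multiset.count i p)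
          (fun s : ℝ => ‖v i + s • w i‖ ^ (-a i)) (Icc 0 1) t‖
      ≤ ∏ i, (M i (Multiset.count i p) * ρ ^ (-a i) *
          (W / ρ) ^ (Multiset.count i (p : Multiset ι))) := by
        refine Finset.prod_le_prod (fun _ _ => norm_nonneg _) fun i _ => ?_
        have hle : Multiset.count i (p : Multiset ι) ≤ N :=
          (Finset.single_le_sum (f := fun i => Multiset.count i (p : Multiset ι))
            (fun _ _ => Nat.zero_le _) (Finset.mem_univ i)).trans_eq hcount
        rw [iteratedFDerivWithin_eq_iteratedFDeriv huniq
          ((hcd i t ht).of_le (by exact_mod_cast hle)) ht]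
        exact hM i _ _ _ _ _ _ hρ (hv i t ht) (hw i)
    _ = _ := by
        rw [Finset.prod_mul_distrib, Finset.prod_mul_distrib, Finset.prod_pow_eq_pow_sum, hcount,
          ← Finset.sum_neg_distrib, Real.rpow_sum_of_pos hρ, mul_assoc]

theorem eqOn_pderiv1 {n : ℕ} {U : Set (Rn n)} (hU : IsOpen U) {f g : Rn n → ℝ}
    (h : EqOn f g U) (i : Fin n) : EqOn (pderiv1 i f) (pderiv1 i g) U := by
  intro y hy
  simp only [pderiv1]
  rw [(h.eventuallyEq_of_mem (hU.mem_nhds hy)).fderiv_eq]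

theorem contDiffOn_pderiv1 {n : ℕ} {U : Set (Rn n)} (hU : IsOpen U) {g : Rn n → ℝ}
    (hg : ContDiffOn ℝ ∞ g U) (i : Fin n) : ContDiffOn ℝ ∞ (pderiv1 i g) U :=
  (hg.fderiv_of_isOpen hU (by simp)).clm_apply contDiffOn_const

theorem pderiv1_comm {n : ℕ} {U : Set (Rn n)} (hU : IsOpen U) {g : Rn n → ℝ}
    (hg : ContDiffOn ℝ ∞ g U) (i j : Fin n) :
    EqOn (pderiv1 i (pderiv1 j g)) (pderiv1 j (pderiv1 i g)) U := by
  intro y hy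
  have hy' : ContDiffAt ℝ ∞ g y := hg.contDiffAt (hU.mem_nhds hy)
  have hd : DifferentiableAt ℝ (fderiv ℝ g) y :=
    (hy'.fderiv_right (m := 1) (by norm_cast)).differentiableAt (by simp)
  have hsymm : IsSymmSndFDerivAt ℝ g y := hy'.isSymmSndFDerivAt (by simp only [minSmoothness_of_isRCLikeNormedField]; norm_cast)
  unfold pderiv1
  rw [fderiv_clm_apply hd (by fun_prop), fderiv_clm_apply hd (by fun_prop)]
  simpa using hsymm.eq _ _

theorem contDiffOn_iterate_pderiv1 {n : ℕ} {U : Set (Rn n)} (hU : IsOpen U) {g : Rn n → ℝ}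
    (hg : ContDiffOn ℝ ∞ g U) (i : Fin n) (p : ℕ) :
    ContDiffOn ℝ ∞ ((pderiv1 i)^[p] g) U := by
  induction p with
  | zero => exact hg
  | succ p ih => rw [Function.iterate_succ_apply']; exact contDiffOn_pderiv1 hU ih i

theorem eqOn_iterate_pderiv1 {n : ℕ} {U : Set (Rn n)} (hU : IsOpen U) {f g : Rn n → ℝ}
    (h : EqOn f g U) (i : Fin n) (p : ℕ) : EqOn ((pderiv1 i)^[p] f) ((pderiv1 i)^[p] g) U := by
  induction p with
  | zero => exact h
  | succ p ih => simp only [Function.iterate_succ_apply']; exact eqOn_pderiv1 hU ih i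

theorem pderiv1_iterate_comm {n : ℕ} {U : Set (Rn n)} (hU : IsOpen U) {g : Rn n → ℝ}
    (hg : ContDiffOn ℝ ∞ g U) (i j : Fin n) (p : ℕ) :
    EqOn (pderiv1 i ((pderiv1 j)^[p] g)) ((pderiv1 j)^[p] (pderiv1 i g)) U := by
  induction p with
  | zero => exact fun _ _ => rfl
  | succ p ih =>
    simp only [Function.iterate_succ_apply']
    exact (pderiv1_comm hU (contDiffOn_iterate_pderiv1 hU hg j p) i j).trans
      (eqOn_pderiv1 hU ih j)

theorem contDiffOn_foldr_pderiv1 {n : ℕ} {U : Set (Rn n)} (hU : IsOpen U) {g : Rn n → ℝ}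
    (hg : ContDiffOn ℝ ∞ g U) (γ : Fin n → ℕ) (l : List (Fin n)) :
    ContDiffOn ℝ ∞ (l.foldr (fun i h => (pderiv1 i)^[γ i] h) g) U := by
  induction l with
  | nil => exact hg
  | cons j l ih => exact contDiffOn_iterate_pderiv1 hU ih j _

theorem foldr_pderiv1_add_single_of_notMem {n : ℕ} (g : Rn n → ℝ) (γ : Fin n → ℕ) (i : Fin n)
    (l : List (Fin n)) (hi : i ∉ l) :
    l.foldr (fun j h => (pderiv1 j)^[(γ + Pi.single i 1 : Fin n → ℕ) j] h) g =
      l.foldr (fun j h => (pderiv1 j)^[γ j] h) g := by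
  induction l with
  | nil => rfl
  | cons j l ih =>
    simp only [List.mem_cons, not_or] at hi
    simp only [List.foldr_cons]
    rw [ih hi.2]
    simp [Pi.single_eq_of_ne (Ne.symm hi.1)]

theorem pderiv1_foldr_pderiv1 {n : ℕ} {U : Set (Rn n)} (hU : IsOpen U) {g : Rn n → ℝ}
    (hg : ContDiffOn ℝ ∞ g U) (γ : Fin n → ℕ) (i : Fin n) (l : List (Fin n)) (hl : l.Nodup)
    (hi : i ∈ l) :
    EqOn (pderiv1 i (l.foldr (fun j h => (pderiv1 j)^[γ j] h) g))
      (l.foldr (fun j h => (pderiv1 j)^[(γ + Pi.single i 1 : Fin n → ℕ) j] h) g) U := by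
  induction l with
  | nil => simp at hi
  | cons j l ih =>
    obtain ⟨hjl, hl⟩ := List.nodup_cons.1 hl
    simp only [List.foldr_cons]
    by_cases hij : i = j
    · subst hij
      rw [foldr_pderiv1_add_single_of_notMem g γ i l hjl]
      simp only [Pi.add_apply, Pi.single_eq_same, Function.iterate_succ_apply']
      exact fun _ _ => rfl
    · have hil : i ∈ l := (List.mem_cons.1 hi).resolve_left hij
      have hj : (γ + Pi.single i 1 : Fin n → ℕ) j = γ j := by
        simp [Pi.single_eq_of_ne (Ne.symm hij)]
      rw [hj]
      exact (pderiv1_iterate_comm hU (contDiffOn_foldr_pderiv1 hU hg γ l) i j _).trans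
        (eqOn_iterate_pderiv1 hU (ih hl hil) j _)

theorem contDiffOn_mderiv {n : ℕ} {U : Set (Rn n)} (hU : IsOpen U) {g : Rn n → ℝ}
    (hg : ContDiffOn ℝ ∞ g U) (γ : Fin n → ℕ) : ContDiffOn ℝ ∞ (mderiv γ g) U :=
  contDiffOn_foldr_pderiv1 hU hg γ _

theorem pderiv1_mderiv {n : ℕ} {U : Set (Rn n)} (hU : IsOpen U) {g : Rn n → ℝ}
    (hg : ContDiffOn ℝ ∞ g U) (γ : Fin n → ℕ) (i : Fin n) :
    EqOn (pderiv1 i (mderiv γ g)) (mderiv (γ + Pi.single i 1) g) U :=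
  pderiv1_foldr_pderiv1 hU hg γ i _ (List.nodup_finRange n) (List.mem_finRange i)

theorem mderiv_zero {n : ℕ} (g : Rn n → ℝ) : mderiv 0 g = g := by
  unfold mderiv
  induction List.finRange n with
  | nil => rfl
  | cons j l ih => simp

/-- The constant-coefficient differential operator with symbol `P`, applied to `g` at `y`. -/
noncomputable def symbolDeriv {n : ℕ} (g : Rn n → ℝ) (y : Rn n) :
    MvPolynomial (Fin n) ℝ →ₗ[ℝ] ℝ :=
  (MvPolynomial.basisMonomials (Fin n) ℝ).constr ℝ (fun γ => mderiv (⇑γ) g y)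

theorem symbolDeriv_monomial {n : ℕ} (g : Rn n → ℝ) (y : Rn n) (γ : Fin n →₀ ℕ) (c : ℝ) :
    symbolDeriv g y (MvPolynomial.monomial γ c) = c * mderiv (⇑γ) g y := by
  have h := (MvPolynomial.basisMonomials (Fin n) ℝ).constr_basis ℝ
    (fun γ => mderiv (⇑γ) g y) γ
  rw [MvPolynomial.coe_basisMonomials] at h
  rw [← mul_one c, ← smul_eq_mul, ← MvPolynomial.smul_monomial, map_smul, symbolDeriv, h]
  simp

/-- The symbol of the directional derivative along `h`. -/
noncomputable def dirSymbol {n : ℕ} (h : Rn n) : MvPolynomial (Fin n) ℝ :=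
  ∑ i, MvPolynomial.monomial (Finsupp.single i 1) (h i)

theorem hasDerivAt_symbolDeriv_line {n : ℕ} {U : Set (Rn n)} (hU : IsOpen U) {g : Rn n → ℝ}
    (hg : ContDiffOn ℝ ∞ g U) (z h : Rn n) (P : MvPolynomial (Fin n) ℝ) {t : ℝ}
    (ht : z + t • h ∈ U) :
    HasDerivAt (fun s : ℝ => symbolDeriv g (z + s • h) P)
      (symbolDeriv g (z + t • h) (P * dirSymbol h)) t := by
  induction P using MvPolynomial.induction_on' with
  | add p q hp hq =>
    simp only [map_add, add_mul]
    exact hp.add hq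
  | monomial γ c =>
    simp only [symbolDeriv_monomial]
    have hd : HasFDerivAt (mderiv (⇑γ) g) (fderiv ℝ (mderiv (⇑γ) g) (z + t • h)) (z + t • h) :=
      (((contDiffOn_mderiv hU hg γ).contDiffAt (hU.mem_nhds ht)).differentiableAt
        (by simp)).hasFDerivAt
    have hl : HasDerivAt (fun s : ℝ => z + s • h) h t := by
      simpa using ((hasDerivAt_id t).smul_const h).const_add z
    convert! (hd.comp_hasDerivAt t hl).const_mul c using 1
    have hh : h = ∑ i, h i • (EuclideanSpace.single i 1 : Rn n) := by
      ext j
      simp [Finset.sum_apply, Pi.single_apply]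
    conv_rhs => rw [hh]
    rw [dirSymbol, Finset.mul_sum, map_sum, map_sum, Finset.mul_sum]
    refine Finset.sum_congr rfl fun i _ => ?_
    rw [MvPolynomial.monomial_mul, symbolDeriv_monomial, map_smul, smul_eq_mul]
    have := pderiv1_mderiv hU hg γ i ht
    rw [pderiv1] at this
    rw [← hh, this, Finsupp.coe_add, Finsupp.single_eq_pi_single]
    ring

theorem iteratedDerivWithin_line {n : ℕ} {U : Set (Rn n)} (hU : IsOpen U) {g : Rn n → ℝ}
    (hg : ContDiffOn ℝ ∞ g U) (z h : Rn n) (hseg : ∀ t ∈ Icc (0 : ℝ) 1, z + t • h ∈ U) (p : ℕ) :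
    ∀ t ∈ Icc (0 : ℝ) 1, iteratedDerivWithin p (fun s : ℝ => g (z + s • h)) (Icc 0 1) t =
      symbolDeriv g (z + t • h) (dirSymbol h ^ p) := by
  induction p with
  | zero =>
    intro t _
    have h1 : (1 : MvPolynomial (Fin n) ℝ) = MvPolynomial.monomial 0 1 := rfl
    rw [pow_zero, h1, symbolDeriv_monomial, iteratedDerivWithin_zero, Finsupp.coe_zero,
      mderiv_zero, one_mul]
  | succ p ih =>
    intro t ht
    rw [iteratedDerivWithin_succ, derivWithin_congr ih (ih t ht), pow_succ]
    exact (hasDerivAt_symbolDeriv_line hU hg z h _ (hseg t ht)).hasDerivWithinAt.derivWithin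
      (uniqueDiffOn_Icc zero_lt_one t ht)

theorem symbolDeriv_dirSymbol_pow {n : ℕ} (g : Rn n → ℝ) (z h : Rn n) (p : ℕ) :
    symbolDeriv g z (dirSymbol h ^ p) = ∑ γ ∈ Finset.piAntidiag Finset.univ p,
      (Nat.multinomial Finset.univ γ : ℝ) * ((∏ i, h i ^ γ i) * mderiv γ g z) := by
  rw [dirSymbol, Finset.sum_pow_eq_sum_piAntidiag, map_sum]
  refine Finset.sum_congr rfl fun γ _ => ?_
  have hmon : ∏ i, (MvPolynomial.monomial (Finsupp.single i 1) (h i) :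
      MvPolynomial (Fin n) ℝ) ^ γ i =
      MvPolynomial.monomial (Finsupp.equivFunOnFinite.symm γ) (∏ i, h i ^ γ i) := by
    rw [MvPolynomial.monomial_eq, Finsupp.prod_fintype _ _ (by simp)]
    simp [← MvPolynomial.C_mul_X_eq_monomial, mul_pow, Finset.prod_mul_distrib]
  rw [hmon, ← nsmul_eq_mul, map_nsmul, symbolDeriv_monomial, nsmul_eq_mul]
  simp

theorem taylorPoly_eq_sum_symbolDeriv {n : ℕ} (d : ℕ) (g : Rn n → ℝ) (z h : Rn n) :
    taylorPoly d g z (z + h) =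
      ∑ p ∈ Finset.range (d + 1), (p.factorial : ℝ)⁻¹ * symbolDeriv g z (dirSymbol h ^ p) := by
  rw [taylorPoly, ← Finset.sum_fiberwise_of_maps_to (s := multiIndices n d)
    (t := Finset.range (d + 1))
    (g := fun γ : Fin n → ℕ => ∑ i, γ i)
    (fun γ hγ => Finset.mem_range_succ_iff.2 (Finset.mem_filter.1 hγ).2)]
  refine Finset.sum_congr rfl fun p hp => ?_
  have hp' : p ≤ d := Finset.mem_range_succ_iff.1 hp
  have hset : (multiIndices n d).filter (fun γ => ∑ i, γ i = p) =
      Finset.piAntidiag Finset.univ p := by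
    ext γ
    simp only [multiIndices, Finset.mem_filter, Fintype.mem_piFinset, Finset.mem_range,
      Finset.mem_piAntidiag, Finset.mem_univ, implies_true, and_true]
    refine ⟨fun h => h.2, fun h => ⟨⟨fun i => ?_, h.trans_le hp'⟩, h⟩⟩
    have hi : γ i ≤ ∑ j, γ j :=
      Finset.single_le_sum (f := γ) (fun _ _ => Nat.zero_le _) (Finset.mem_univ i)
    exact Nat.lt_succ_of_le (hi.trans (h.trans_le hp'))
  rw [hset, symbolDeriv_dirSymbol_pow, Finset.mul_sum]
  refine Finset.sum_congr rfl fun γ hγ => ?_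
  have hmul := Nat.multinomial_spec Finset.univ γ
  rw [(Finset.mem_piAntidiag.1 hγ).1] at hmul
  have hmul' : (mfact γ : ℝ) * (Nat.multinomial Finset.univ γ : ℝ) = (p.factorial : ℝ) := by
    rw [mfact]; exact_mod_cast hmul
  have h1 : (mfact γ : ℝ) ≠ 0 := by
    rw [mfact]; exact_mod_cast Finset.prod_ne_zero_iff.2 fun i _ => (γ i).factorial_ne_zero
  have h2 : (Nat.multinomial Finset.univ γ : ℝ) ≠ 0 := by
    intro h; rw [h, mul_zero] at hmul'; exact p.factorial_ne_zero (by exact_mod_cast hmul'.symm)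
  rw [← hmul']
  simp only [PiLp.add_apply, add_sub_cancel_left]
  field_simp

theorem taylorPoly_eq_taylorWithinEval {n : ℕ} {U : Set (Rn n)} (hU : IsOpen U) {g : Rn n → ℝ}
    (hg : ContDiffOn ℝ ∞ g U) (z h : Rn n) (hseg : ∀ t ∈ Icc (0 : ℝ) 1, z + t • h ∈ U) (d : ℕ) :
    taylorPoly d g z (z + h) =
      taylorWithinEval (fun s : ℝ => g (z + s • h)) d (Icc 0 1) 0 1 := by
  rw [taylorPoly_eq_sum_symbolDeriv, taylor_within_apply]
  refine Finset.sum_congr rfl fun p _ => ?_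
  rw [iteratedDerivWithin_line hU hg z h hseg p 0 (by simp)]
  simp

theorem abs_sub_taylorPoly_le {n : ℕ} {U : Set (Rn n)} (hU : IsOpen U) {g : Rn n → ℝ}
    (hg : ContDiffOn ℝ ∞ g U) (z h : Rn n) (hseg : ∀ t ∈ Icc (0 : ℝ) 1, z + t • h ∈ U) (d : ℕ)
    {B : ℝ} (hB : ∀ t ∈ Icc (0 : ℝ) 1,
      ‖iteratedDerivWithin (d + 1) (fun s : ℝ => g (z + s • h)) (Icc 0 1) t‖ ≤ B) :
    |g (z + h) - taylorPoly d g z (z + h)| ≤ B := by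
  have hcd : ContDiffOn ℝ (d + 1) (fun s : ℝ => g (z + s • h)) (Icc 0 1) :=
    (hg.of_le (by exact_mod_cast le_top)).comp (by fun_prop) hseg
  have key := taylor_mean_remainder_bound zero_le_one hcd (right_mem_Icc.2 zero_le_one) hB
  rw [← taylorPoly_eq_taylorWithinEval hU hg z h hseg, one_smul, sub_zero, one_pow, mul_one,
    Real.norm_eq_abs] at key
  have hB0 : 0 ≤ B := (norm_nonneg _).trans (hB 0 (by simp))
  exact key.trans (div_le_self hB0 (by exact_mod_cast d.factorial_pos))

theorem mApp_add_smul {n : ℕ} (A : Matrix (Fin n) (Fin n) ℝ) (z h : Rn n) (t : ℝ) :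
    mApp A (z + t • h) = mApp A z + t • mApp A h := by
  simp [mApp]

theorem continuous_mApp {n : ℕ} (A : Matrix (Fin n) (Fin n) ℝ) : Continuous (mApp A) :=
  (Matrix.toEuclideanLin A).continuous_of_finiteDimensional

theorem contDiff_mApp {n : ℕ} (A : Matrix (Fin n) (Fin n) ℝ) {p : WithTop ℕ∞} :
    ContDiff ℝ p (mApp A) :=
  (LinearMap.toContinuousLinearMap (Matrix.toEuclideanLin A)).contDiff

theorem norm_mApp_le {n : ℕ} (A : Matrix (Fin n) (Fin n) ℝ) (x : Rn n) :
    ‖mApp A x‖ ≤ opNorm A * ‖x‖ :=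
  (Matrix.toEuclideanCLM (𝕜 := ℝ) A).le_opNorm x

theorem opNorm_pos {n : ℕ} (hn : 0 < n) {A : Matrix (Fin n) (Fin n) ℝ} (hA : IsUnit A) :
    0 < opNorm A := by
  have : Nonempty (Fin n) := ⟨⟨0, hn⟩⟩
  have hne : Matrix.toEuclideanCLM (𝕜 := ℝ) A ≠ 0 := by
    simpa using hA.ne_zero
  exact norm_pos_iff.2 hne

theorem norm_sub_le_of_mem_cube {n : ℕ} {z y : Rn n} {r : ℝ} (hr : 0 < r) (hy : y ∈ cube z r) :
    ‖y - z‖ ≤ Real.sqrt n / 2 * r := by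
  rw [EuclideanSpace.norm_eq]
  refine Real.sqrt_le_iff.2 ⟨by positivity, ?_⟩
  calc ∑ i, ‖(y - z) i‖ ^ 2 ≤ ∑ _i : Fin n, (r / 2) ^ 2 := by
        refine Finset.sum_le_sum fun i _ => ?_
        have := hy i
        simp only [PiLp.sub_apply, Real.norm_eq_abs]
        gcongr
    _ = (Real.sqrt n / 2 * r) ^ 2 := by
        rw [mul_pow, div_pow (Real.sqrt n), Real.sq_sqrt n.cast_nonneg]
        simp only [Finset.sum_const, Finset.card_univ, Fintype.card_fin, nsmul_eq_mul]
        ring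

theorem isOpen_kern_regular {n m : ℕ} (A : Fin m → Matrix (Fin n) (Fin n) ℝ) (x : Rn n) :
    IsOpen {y : Rn n | ∀ i, x - mApp (A i) y ≠ 0} := by
  simp only [ofPred_forall]
  exact isOpen_iInter_of_finite fun i =>
    isOpen_ne_fun (continuous_const.sub (continuous_mApp (A i))) continuous_const

theorem contDiffOn_kern {n m : ℕ} (A : Fin m → Matrix (Fin n) (Fin n) ℝ) (αe : Fin m → ℝ)
    (x : Rn n) {p : WithTop ℕ∞} :
    ContDiffOn ℝ p (kern A αe x) {y : Rn n | ∀ i, x - mApp (A i) y ≠ 0} := by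
  refine contDiffOn_prod fun i _ => ?_
  exact (contDiffOn_norm_rpow (-αe i)).comp
    (contDiff_const.sub (contDiff_mApp (A i))).contDiffOn fun y hy => hy i

theorem kernel_taylor_remainder_estimate
    {n m : ℕ} (hm : 1 ≤ m)
    (A : Fin m → Matrix (Fin n) (Fin n) ℝ) (hA : ∀ i, IsUnit (A i))
    (α : ℝ) (hα0 : 0 ≤ α) (hαn : α < n)
    (αe : Fin m → ℝ) (hαe : ∀ i, 0 < αe i) (hsum : ∑ i, αe i = (n : ℝ) - α)
    (d : ℕ) (κ : ℝ) (hκ : Real.sqrt n / 2 < κ) :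
    ∃ C > 0, ∀ (z : Rn n) (r : ℝ), 0 < r → ∀ y ∈ cube z r, ∀ (x : Rn n) (k : Fin m),
      (∀ i, κ * (⨆ j, opNorm (A j)) * r ≤ ‖x - mApp (A i) z‖) →
      (∀ i, ‖x - mApp (A k) z‖ ≤ ‖x - mApp (A i) z‖) →
      |kern A αe x y - taylorPoly d (kern A αe x) z y| ≤
        C * r ^ (d + 1) * ‖x - mApp (A k) z‖ ^ (-((n : ℝ) - α + d + 1)) := by
  have hn : 0 < n := by exact_mod_cast hα0.trans_lt hαn
  set D : ℝ := ⨆ j, opNorm (A j) with hD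
  have hAD : ∀ i, opNorm (A i) ≤ D := fun i =>
    le_ciSup (f := fun j => opNorm (A j)) (finite_range _).bddAbove i
  have hDpos : 0 < D := (opNorm_pos hn (hA ⟨0, hm⟩)).trans_le (hAD _)
  have hκ0 : 0 < κ := lt_of_le_of_lt (by positivity) hκ
  obtain ⟨M, hM0, hM⟩ := exists_norm_iteratedDerivWithin_prod_line_le (Rn n) hαe (d + 1)
  set c : ℝ := 1 - Real.sqrt n / 2 / κ with hc
  have hcpos : 0 < c := sub_pos.2 ((div_lt_one hκ0).2 hκ)
  set w : ℝ := D * (Real.sqrt n / 2) with hw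
  have hwpos : 0 < w := by positivity
  set C₀ : ℝ := M * c ^ (-∑ i, αe i) * (w / c) ^ (d + 1) with hC₀
  refine ⟨C₀ + 1, by positivity, fun z r hr y hy x k hx hk => ?_⟩
  set R : ℝ := ‖x - mApp (A k) z‖ with hR
  have hRpos : 0 < R := lt_of_lt_of_le (by positivity) (hx k)
  set h : Rn n := y - z with hh
  have hyz : y = z + h := by rw [hh]; abel
  have hhn : ‖h‖ ≤ Real.sqrt n / 2 * r := norm_sub_le_of_mem_cube hr hy
  have hAh : ∀ i, ‖mApp (A i) h‖ ≤ w * r := fun i => by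
    calc ‖mApp (A i) h‖ ≤ opNorm (A i) * ‖h‖ := norm_mApp_le _ _
      _ ≤ D * (Real.sqrt n / 2 * r) := mul_le_mul (hAD i) hhn (norm_nonneg _) hDpos.le
      _ = w * r := by rw [hw]; ring
  have hline : ∀ i (t : ℝ), x - mApp (A i) (z + t • h) =
      (x - mApp (A i) z) + t • (-mApp (A i) h) := fun i t => by
    rw [mApp_add_smul, smul_neg]; abel
  have hlower : ∀ i, ∀ t ∈ Icc (0 : ℝ) 1,
      c * R ≤ ‖(x - mApp (A i) z) + t • (-mApp (A i) h)‖ := by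
    intro i t ht
    have h1 : ‖t • mApp (A i) h‖ ≤ w * r := by
      rw [norm_smul, Real.norm_of_nonneg ht.1]
      exact (mul_le_of_le_one_left (norm_nonneg _) ht.2).trans (hAh i)
    have h2 : w * r ≤ Real.sqrt n / 2 / κ * ‖x - mApp (A i) z‖ := by
      calc w * r = Real.sqrt n / 2 / κ * (κ * D * r) := by rw [hw]; field_simp
        _ ≤ _ := by gcongr; exact hx i
    calc c * R ≤ c * ‖x - mApp (A i) z‖ := by gcongr; exact hk i
      _ ≤ ‖x - mApp (A i) z‖ - ‖t • mApp (A i) h‖ := by rw [hc]; linarith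
      _ ≤ ‖(x - mApp (A i) z) - t • mApp (A i) h‖ := norm_sub_norm_le _ _
      _ = _ := by rw [smul_neg, sub_eq_add_neg]
  have hcR : 0 < c * R := mul_pos hcpos hRpos
  have hseg : ∀ t ∈ Icc (0 : ℝ) 1, z + t • h ∈ {y : Rn n | ∀ i, x - mApp (A i) y ≠ 0} := by
    intro t ht i
    rw [hline]
    exact norm_pos_iff.1 (hcR.trans_le (hlower i t ht))
  have hfun : (fun s : ℝ => kern A αe x (z + s • h)) =
      fun s : ℝ => ∏ i, ‖(x - mApp (A i) z) + s • (-mApp (A i) h)‖ ^ (-αe i) := by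
    ext s
    simp only [kern, hline]
  have hbound := hM (fun i => x - mApp (A i) z) (fun i => -mApp (A i) h) (c * R) (w * r) hcR
    hlower (fun i => by rw [norm_neg]; exact hAh i)
  rw [← hfun] at hbound
  have key := abs_sub_taylorPoly_le (isOpen_kern_regular A x) (contDiffOn_kern A αe x) z h hseg d
    hbound
  rw [← hyz] at key
  have hexp : R ^ (-((n : ℝ) - α + d + 1)) = R ^ (-∑ i, αe i) / R ^ (d + 1) := by
    rw [hsum, ← Real.rpow_natCast R (d + 1), ← Real.rpow_sub hRpos]
    congr 1
    push_cast
    ring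
  calc _ ≤ M * (c * R) ^ (-∑ i, αe i) * (w * r / (c * R)) ^ (d + 1) := key
    _ = C₀ * r ^ (d + 1) * R ^ (-((n : ℝ) - α + d + 1)) := by
        rw [hexp, Real.mul_rpow hcpos.le hRpos.le, hC₀, div_pow, div_pow,
          mul_pow w, mul_pow c]
        field_simp
    _ ≤ _ := by gcongr; linarith
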